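/- Let X be an integer-valued random variable, m ≥ 2 an integer, and t = 2πl/m with 0 ≤ l < m. Let q(m, X) be the second largest value among P(X ≡ u mod m), u = 0, 1, ..., m−1. Then |E(e^{itX})| ≥ 1 − 2m·q(m, X). In particular, if q(m, X) ≤ 1/(4m) then |E(e^{itX})| ≥ 1/2. -/

import Mathlib

open MeasureTheory ProbabilityTheory Filter
open scoped Topology

noncomputable section

namespace EdgeworthPaper

variable {Ω : Type*} [MeasureSpace Ω]

/-- `q(m,X)`: the second largest among `P(X ≡ u mod m)`, `u ∈ ℤ/mℤ` (i.e. the largest,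
over pairs of distinct residues, of the smaller of the two probabilities). -/
def q2 (X : Ω → ℤ) (m : ℕ) : ℝ :=
  sSup {x | ∃ i j : ZMod m, i ≠ j ∧
    x = min ((ℙ {ω | ((X ω : ZMod m)) = i}).toReal) ((ℙ {ω | ((X ω : ZMod m)) = j}).toReal)}

lemma bddAbove_q2 [IsProbabilityMeasure (ℙ : Measure Ω)] (X : Ω → ℤ) (m : ℕ) :
    BddAbove {x | ∃ i j : ZMod m, i ≠ j ∧
      x = min ((ℙ {ω | ((X ω : ZMod m)) = i}).toReal)
        ((ℙ {ω | ((X ω : ZMod m)) = j}).toReal)} := by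
  refine ⟨1, ?_⟩
  rintro x ⟨i, j, -, rfl⟩
  exact (min_le_left _ _).trans measureReal_le_one

lemma q2_nonneg (X : Ω → ℤ) (m : ℕ) : 0 ≤ q2 X m := by
  refine Real.sSup_nonneg ?_
  rintro x ⟨i, j, -, rfl⟩
  exact le_min ENNReal.toReal_nonneg ENNReal.toReal_nonneg

/-- Some residue class carries all but at most `m * q2 X m` of the mass. -/
lemma exists_measureReal_ne_le [IsProbabilityMeasure (ℙ : Measure Ω)] (X : Ω → ℤ) (m : ℕ)
    [NeZero m] :
    ∃ i : ZMod m, (ℙ : Measure Ω).real {ω | ((X ω : ZMod m)) ≠ i} ≤ m * q2 X m := by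
  obtain ⟨i, hi⟩ := Finite.exists_max
    fun i : ZMod m => (ℙ : Measure Ω).real {ω | ((X ω : ZMod m)) = i}
  refine ⟨i, ?_⟩
  have hunion : {ω | ((X ω : ZMod m)) ≠ i} =
      ⋃ j ∈ Finset.univ.erase i, {ω | ((X ω : ZMod m)) = j} := by
    ext ω
    simp
  have hle : ∀ j ∈ Finset.univ.erase i,
      (ℙ : Measure Ω).real {ω | ((X ω : ZMod m)) = j} ≤ q2 X m := fun j hj =>
    le_csSup (bddAbove_q2 X m)
      ⟨i, j, (Finset.ne_of_mem_erase hj).symm, (min_eq_right (hi j)).symm⟩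
  calc (ℙ : Measure Ω).real {ω | ((X ω : ZMod m)) ≠ i}
      ≤ ∑ j ∈ Finset.univ.erase i, (ℙ : Measure Ω).real {ω | ((X ω : ZMod m)) = j} := by
        rw [hunion]
        exact measureReal_biUnion_finset_le _ _
    _ ≤ (Finset.univ.erase i).card • q2 X m := Finset.sum_le_card_nsmul _ _ _ hle
    _ ≤ m * q2 X m := by
        rw [nsmul_eq_mul]
        refine mul_le_mul_of_nonneg_right ?_ (q2_nonneg X m)
        exact_mod_cast (Finset.card_le_univ _).trans_eq (ZMod.card m)

lemma norm_exp_I_mul_ofReal_mul_intCast (t : ℝ) (a : ℤ) :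
    ‖Complex.exp (Complex.I * (t : ℂ) * (a : ℂ))‖ = 1 := by
  rw [show Complex.I * (t : ℂ) * (a : ℂ) = Complex.I * ((t * a : ℝ) : ℂ) by push_cast; ring]
  exact Complex.norm_exp_I_mul_ofReal _

lemma exp_eq_of_intCast_zmod_eq (m l : ℕ) [NeZero m] {a b : ℤ} (h : (a : ZMod m) = b) :
    Complex.exp (Complex.I * ((2 * Real.pi * l / m : ℝ) : ℂ) * (a : ℂ)) =
      Complex.exp (Complex.I * ((2 * Real.pi * l / m : ℝ) : ℂ) * (b : ℂ)) := by
  obtain ⟨k, hk⟩ := (ZMod.intCast_eq_intCast_iff_dvd_sub b a m).1 h.symm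
  have hm : (m : ℂ) ≠ 0 := Nat.cast_ne_zero.2 (NeZero.ne m)
  refine Complex.exp_eq_exp_iff_exists_int.2 ⟨l * k, ?_⟩
  rw [show a = b + m * k by linarith]
  push_cast
  field_simp

/-- A random variable on the unit circle that equals a constant off the set `A` has mean of
norm at least `1 - 2 * P(A)`. -/
lemma one_sub_le_norm_integral [IsProbabilityMeasure (ℙ : Measure Ω)] {f : Ω → ℂ}
    (hf : Integrable f ℙ) (hf1 : ∀ ω, ‖f ω‖ = 1) {c : ℂ} (hc : ‖c‖ = 1) {A : Set Ω}
    (hfc : ∀ ω ∉ A, f ω = c) :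
    1 - 2 * (ℙ : Measure Ω).real A ≤ ‖∫ ω, f ω‖ := by
  have hbound : ‖∫ ω, (c - f ω)‖ ≤ 2 * (ℙ : Measure Ω).real A := by
    rw [← setIntegral_eq_integral_of_forall_compl_eq_zero (s := A)
      fun ω hω => by rw [hfc ω hω, sub_self]]
    refine norm_setIntegral_le_of_norm_le_const (measure_lt_top _ _) fun ω _ => ?_
    exact (norm_sub_le _ _).trans (by rw [hc, hf1]; norm_num)
  rw [integral_sub (integrable_const c) hf, integral_const, probReal_univ, one_smul] at hbound
  linarith [norm_sub_norm_le c (∫ ω, f ω)]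

/-- For an integer-valued random variable `X` and `t = 2πl/m`,
`|E(e^{itX})| ≥ 1 - 2m·q(m,X)`; in particular, if `q(m,X) ≤ 1/(4m)` then
`|E(e^{itX})| ≥ 1/2`. -/
theorem char_lower_bound
    {Ω : Type*} [MeasureSpace Ω] [IsProbabilityMeasure (ℙ : Measure Ω)]
    (X : Ω → ℤ) (hX : Measurable X) (m : ℕ) (hm : 2 ≤ m) (l : ℕ) (hl : l < m) :
    1 - 2 * m * q2 X m ≤
        ‖∫ ω, Complex.exp (Complex.I * ((2 * Real.pi * l / m : ℝ) : ℂ) * (X ω : ℂ))‖ ∧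
      (q2 X m ≤ 1 / (4 * m) →
        (1 : ℝ) / 2 ≤
          ‖∫ ω, Complex.exp (Complex.I * ((2 * Real.pi * l / m : ℝ) : ℂ) * (X ω : ℂ))‖) := by
  have : NeZero m := ⟨by omega⟩
  have main : 1 - 2 * m * q2 X m ≤
      ‖∫ ω, Complex.exp (Complex.I * ((2 * Real.pi * l / m : ℝ) : ℂ) * (X ω : ℂ))‖ := by
    obtain ⟨i, hi⟩ := exists_measureReal_ne_le X m
    obtain ⟨a, rfl⟩ := ZMod.intCast_surjective i
    have hmeas : Measurable fun ω =>
        Complex.exp (Complex.I * ((2 * Real.pi * l / m : ℝ) : ℂ) * (X ω : ℂ)) :=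
      (measurable_of_countable fun n : ℤ =>
        Complex.exp (Complex.I * ((2 * Real.pi * l / m : ℝ) : ℂ) * (n : ℂ))).comp hX
    have hint := one_sub_le_norm_integral (A := {ω | ((X ω : ZMod m)) ≠ (a : ZMod m)})
      (Integrable.of_bound hmeas.aestronglyMeasurable 1
        (ae_of_all _ fun ω => (norm_exp_I_mul_ofReal_mul_intCast _ (X ω)).le))
      (fun ω => norm_exp_I_mul_ofReal_mul_intCast _ (X ω))
      (norm_exp_I_mul_ofReal_mul_intCast _ a)
      (fun ω hω => exp_eq_of_intCast_zmod_eq m l (not_not.1 hω))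
    linarith
  refine ⟨main, fun hq => le_trans ?_ main⟩
  have hm0 : (0 : ℝ) < m := by exact_mod_cast (by omega : 0 < m)
  rw [le_div_iff₀ (by positivity)] at hq
  linarith

end EdgeworthPaper
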